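/- Let G be a digraph with transitive closure Ḡ, let f̄ be a discrete Morse function on Ḡ, with V̄ = grad f̄ and Φ̄ = Id + ∂V̄ + V̄∂ on Ḡ. Suppose Ω_*(G) is V̄-invariant (V̄(Ω_n(G)) ⊆ Ω_{n+1}(G) for all n) and Φ̄(α) ∈ Ω(G) for every allowed elementary path α on G that is critical in Ḡ. Let T_n : Crit_n(Ḡ) ∩ P_n(G) → P_n^Φ̄(Ḡ) ∩ Ω_n(G) be the linear isomorphism α ↦ α + V̄∂(α) and ∂̃_n = T_{n−1}^{−1} ∘ ∂_n ∘ T_n. Then for every m ≥ 0, H_m({Crit_n(Ḡ) ∩ P_n(G), ∂̃_n}) ≅ H_m(G;ℝ). -/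

import Mathlib

open scoped BigOperators Classical

namespace PathMorse

/-- A digraph: an irreflexive edge relation on a vertex set. -/
structure Digraph (V : Type) where
  E : V → V → Prop
  irrefl : ∀ v, ¬ E v v

/-- A digraph is transitive if `u→v` and `v→w` imply `u→w`. -/
def Digraph.Transitive {V : Type} (G : Digraph V) : Prop :=
  ∀ u v w, G.E u v → G.E v w → G.E u w

/-- `Gbar` is the transitive closure of `G`: the smallest transitive digraph containing `G`. -/
def IsTransClosure {V : Type} (G Gbar : Digraph V) : Prop :=
  Gbar.Transitive ∧ (∀ u v, G.E u v → Gbar.E u v) ∧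
    ∀ H : Digraph V, H.Transitive → (∀ u v, G.E u v → H.E u v) →
      ∀ u v, Gbar.E u v → H.E u v

/-- An elementary `n`-path on `V`: a sequence of `n+1` vertices. -/
abbrev Path (V : Type) (n : ℕ) := Fin (n+1) → V

/-- An elementary path is allowed on `G` if consecutive vertices are joined by directed edges. -/
def Allowed {V : Type} (G : Digraph V) {n : ℕ} (p : Path V n) : Prop :=
  ∀ i : Fin n, G.E (p i.castSucc) (p i.succ)

/-- The `i`-th face of a path: delete the `i`-th vertex. -/
def face {V : Type} {n : ℕ} (i : Fin (n+2)) (p : Path V (n+1)) : Path V n :=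
  p ∘ i.succAbove

/-- `q` is obtained from `p` by deleting one vertex (the codimension-one relation `q < p`). -/
def IsFace {V : Type} {n : ℕ} (q : Path V n) (p : Path V (n+1)) : Prop :=
  ∃ i : Fin (n+2), face i p = q

/-- Value of `f` on a path: sum of the values at the vertices. -/
def fPath {V : Type} (f : V → ℝ) {n : ℕ} (p : Path V n) : ℝ :=
  ∑ i, f (p i)

/-- There is an allowed coface `γ > p` with `f γ = f p`. -/
def HasEqualCoface {V : Type} (G : Digraph V) (f : V → ℝ) {n : ℕ} (p : Path V n) : Prop :=
  ∃ γ : Path V (n+1), Allowed G γ ∧ IsFace p γ ∧ fPath f γ = fPath f p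

/-- There is an allowed face `β < p` with `f β = f p`. -/
def HasEqualFace {V : Type} (G : Digraph V) (f : V → ℝ) : (n : ℕ) → Path V n → Prop
  | 0, _ => False
  | (n+1), p => ∃ β : Path V n, Allowed G β ∧ IsFace β p ∧ fPath f β = fPath f p

/-- A discrete Morse function on a digraph: nonnegative, and for each allowed elementary path
there is at most one allowed coface with the same value, and at most one allowed face with the
same value. -/
def IsMorse {V : Type} (G : Digraph V) (f : V → ℝ) : Prop :=
  (∀ v, 0 ≤ f v) ∧
  (∀ n (α : Path V n), Allowed G α →
    ∀ γ₁ γ₂ : Path V (n+1), Allowed G γ₁ → Allowed G γ₂ → IsFace α γ₁ → IsFace α γ₂ →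
      fPath f γ₁ = fPath f α → fPath f γ₂ = fPath f α → γ₁ = γ₂) ∧
  (∀ n (α : Path V (n+1)), Allowed G α →
    ∀ β₁ β₂ : Path V n, Allowed G β₁ → Allowed G β₂ → IsFace β₁ α → IsFace β₂ α →
      fPath f β₁ = fPath f α → fPath f β₂ = fPath f α → β₁ = β₂)

/-- A critical path: allowed, with no allowed coface of equal value, no allowed face of equal value. -/
def IsCritical {V : Type} (G : Digraph V) (f : V → ℝ) {n : ℕ} (p : Path V n) : Prop :=
  Allowed G p ∧ ¬ HasEqualCoface G f p ∧ ¬ HasEqualFace G f n p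

/-- `n`-chains: the real vector space with (orthonormal) basis the elementary `n`-paths. -/
abbrev Chain (V : Type) (n : ℕ) := Path V n → ℝ

variable {V : Type} [Fintype V] [DecidableEq V]

/-- The basis chain corresponding to an elementary path. -/
def unitP {n : ℕ} (p : Path V n) : Chain V n := Pi.single p 1

/-- The boundary operator on chains (as a bare function). -/
def boundaryFun {n : ℕ} (x : Chain V (n+1)) : Chain V n :=
  fun q => ∑ p : Path V (n+1), x p * ∑ i : Fin (n+2), ((-1:ℝ)^(i:ℕ)) * (if face i p = q then 1 else 0)

/-- The boundary operator `∂ = Σ (-1)^i d_i` as a linear map. -/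
def boundary (V : Type) [Fintype V] [DecidableEq V] (n : ℕ) : Chain V (n+1) →ₗ[ℝ] Chain V n where
  toFun := boundaryFun
  map_add' x y := by
    funext q
    simp [boundaryFun, add_mul, Finset.sum_add_distrib]
  map_smul' c x := by
    funext q
    simp [boundaryFun, Finset.mul_sum, mul_assoc]

/-- `P_n(G)`: the span of the allowed elementary `n`-paths. -/
def pSpan (G : Digraph V) (n : ℕ) : Submodule ℝ (Chain V n) :=
  Submodule.span ℝ {x : Chain V n | ∃ p : Path V n, Allowed G p ∧ x = unitP p}

/-- `Ω_n(G) = {x ∈ P_n(G) : ∂x ∈ P_{n-1}(G)}` (with `Ω_0 = P_0`). -/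
def omega (G : Digraph V) : (n : ℕ) → Submodule ℝ (Chain V n)
  | 0 => pSpan G 0
  | (n+1) => pSpan G (n+1) ⊓ (pSpan G n).comap (boundary V n)

/-- The discrete gradient vector field on a basis path: `V(α) = -⟨∂γ,α⟩ γ` if there is an
allowed coface `γ > α` with `f γ = f α`, and `0` otherwise. -/
noncomputable def gradFun (G : Digraph V) (f : V → ℝ) {n : ℕ} (α : Path V n) : Chain V (n+1) :=
  if h : Allowed G α ∧ ∃ γ : Path V (n+1), Allowed G γ ∧ IsFace α γ ∧ fPath f γ = fPath f α then
    (-(boundary V n (unitP h.2.choose) α)) • unitP h.2.choose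
  else 0

/-- The discrete gradient vector field `V = grad f`, extended linearly to chains. -/
noncomputable def grad (G : Digraph V) (f : V → ℝ) (n : ℕ) : Chain V n →ₗ[ℝ] Chain V (n+1) where
  toFun x := ∑ α : Path V n, x α • gradFun G f α
  map_add' x y := by simp [add_smul, Finset.sum_add_distrib]
  map_smul' c x := by simp [Finset.smul_sum, smul_smul]

/-- The composite `V∂` in degree `n` (zero in degree `0`). -/
noncomputable def vd (G : Digraph V) (f : V → ℝ) : (n : ℕ) → (Chain V n →ₗ[ℝ] Chain V n)
  | 0 => 0
  | (n+1) => (grad G f n).comp (boundary V n)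

/-- The discrete gradient flow `Φ = Id + ∂V + V∂`. -/
noncomputable def flow (G : Digraph V) (f : V → ℝ) (n : ℕ) : Chain V n →ₗ[ℝ] Chain V n :=
  LinearMap.id + (boundary V n).comp (grad G f n) + vd G f n

/-- `P_n^Φ(G) = {x ∈ P_n(G) : Φ x = x}`. -/
noncomputable def pPhi (G : Digraph V) (f : V → ℝ) (n : ℕ) : Submodule ℝ (Chain V n) :=
  pSpan G n ⊓ LinearMap.ker (flow G f n - LinearMap.id)

/-- The cycles of a chain complex of subspaces `C` with differentials `D`
(in degree `0`, everything is a cycle). -/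
def cycles (C : ∀ n, Submodule ℝ (Chain V n)) (D : ∀ n, Chain V (n+1) →ₗ[ℝ] Chain V n) :
    (m : ℕ) → Submodule ℝ (Chain V m)
  | 0 => C 0
  | (m+1) => C (m+1) ⊓ LinearMap.ker (D m)

/-- Homology of the chain complex `(C, D)`: cycles modulo boundaries coming from `C`. -/
abbrev Homology (C : ∀ n, Submodule ℝ (Chain V n)) (D : ∀ n, Chain V (n+1) →ₗ[ℝ] Chain V n)
    (m : ℕ) :=
  (cycles C D m) ⧸ (Submodule.comap (cycles C D m).subtype ((C (m+1)).map (D m)))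

/-- The operator `e^{tf}` on chains. -/
noncomputable def expOp (f : V → ℝ) (t : ℝ) (n : ℕ) : Chain V n →ₗ[ℝ] Chain V n where
  toFun x := fun p => Real.exp (t * fPath f p) * x p
  map_add' x y := by funext p; simp [mul_add]
  map_smul' c x := by funext p; simp; ring

/-- The deformed boundary `∂_t = e^{tf} ∂ e^{-tf}`. -/
noncomputable def dT (f : V → ℝ) (t : ℝ) (n : ℕ) : Chain V (n+1) →ₗ[ℝ] Chain V n :=
  (expOp f t n).comp ((boundary V n).comp (expOp f (-t) (n+1)))

/-- The span of the elementary `n`-paths that are critical in `Gbar` and allowed in `G`. -/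
def critSpan (G Gbar : Digraph V) (f : V → ℝ) (n : ℕ) : Submodule ℝ (Chain V n) :=
  Submodule.span ℝ {x : Chain V n | ∃ α : Path V n, IsCritical Gbar f α ∧ Allowed G α ∧ x = unitP α}

lemma boundary_apply {n : ℕ} (x : Chain V (n+1)) (q : Path V n) :
    boundary V n x q = ∑ p : Path V (n+1), x p *
      ∑ i : Fin (n+2), ((-1:ℝ)^(i:ℕ)) * (if face i p = q then 1 else 0) := rfl

lemma boundary_unitP {n : ℕ} (p : Path V (n+1)) :
    boundary V n (unitP p) = ∑ i : Fin (n+2), ((-1:ℝ)^(i:ℕ)) • unitP (face i p) := by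
  funext q
  rw [boundary_apply, Finset.sum_eq_single p]
  · simp [unitP, Pi.single_apply, eq_comm]
  · intro b _ hb
    simp [unitP, hb]
  · simp

lemma sum_smul_unitP {n : ℕ} (x : Chain V n) : ∑ p, x p • unitP p = x := by
  funext q
  simp [unitP, Pi.single_apply]

lemma linearMap_ext_unitP {n : ℕ} {M : Type*} [AddCommGroup M] [Module ℝ M]
    {A B : Chain V n →ₗ[ℝ] M} (h : ∀ p, A (unitP p) = B (unitP p)) : A = B := by
  ext x
  simpa [unitP] using h x

lemma boundary_comp_boundary (n : ℕ) : (boundary V n).comp (boundary V (n+1)) = 0 := by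
  refine linearMap_ext_unitP fun p => ?_
  simp only [LinearMap.comp_apply, boundary_unitP, map_sum, map_smul, LinearMap.zero_apply,
    Finset.smul_sum]
  rw [← Fintype.sum_prod_type']
  refine Finset.sum_involution (fun a _ => (a.1.succAbove a.2, a.2.predAbove a.1))
    ?_ ?_ (by simp) ?_
  · rintro ⟨i, j⟩ -
    have hface : face (j.predAbove i) (face (i.succAbove j) p) = face j (face i p) := by
      funext k
      simp [face, Fin.succAbove_succAbove_succAbove_predAbove]
    simp only [hface, smul_smul, ← pow_add, Fin.neg_one_pow_succAbove_add_predAbove]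
    rw [neg_smul, add_neg_cancel]
  · rintro ⟨i, j⟩ - _ h
    exact Fin.succAbove_ne i j (congrArg Prod.fst h)
  · rintro ⟨i, j⟩ -
    simp [Fin.succAbove_succAbove_predAbove, Fin.predAbove_predAbove_succAbove]

lemma boundary_boundary {n : ℕ} (x : Chain V (n+2)) :
    boundary V n (boundary V (n+1) x) = 0 :=
  LinearMap.congr_fun (boundary_comp_boundary n) x

lemma mem_span_unitP_iff {n : ℕ} (P : Path V n → Prop) (x : Chain V n) :
    x ∈ Submodule.span ℝ {y : Chain V n | ∃ p, P p ∧ y = unitP p} ↔ ∀ p, ¬ P p → x p = 0 := by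
  constructor
  · intro hx q hq
    induction hx using Submodule.span_induction with
    | mem y hy =>
      obtain ⟨p, hp, rfl⟩ := hy
      have : q ≠ p := fun h => hq (h ▸ hp)
      simp [unitP, this]
    | zero => rfl
    | add y z _ _ hy hz => simp [hy, hz]
    | smul c y _ hy => simp [hy]
  · intro h
    rw [← sum_smul_unitP x]
    refine Submodule.sum_mem _ fun p _ => ?_
    by_cases hp : P p
    · exact Submodule.smul_mem _ _ (Submodule.subset_span ⟨p, hp, rfl⟩)
    · simp [h p hp]

lemma mem_pSpan_iff {G : Digraph V} {n : ℕ} {x : Chain V n} :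
    x ∈ pSpan G n ↔ ∀ p, ¬ Allowed G p → x p = 0 :=
  mem_span_unitP_iff _ x

lemma mem_critSpan_iff {G Gbar : Digraph V} {f : V → ℝ} {n : ℕ} {x : Chain V n} :
    x ∈ critSpan G Gbar f n ↔ ∀ p, ¬ (IsCritical Gbar f p ∧ Allowed G p) → x p = 0 := by
  rw [← mem_span_unitP_iff]
  simp only [critSpan, and_assoc]

lemma omega_le_pSpan (G : Digraph V) : ∀ n, omega G n ≤ pSpan G n
  | 0 => le_rfl
  | _ + 1 => inf_le_left

lemma boundary_mem_omega {G : Digraph V} : ∀ {n : ℕ} {x : Chain V (n+1)},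
    x ∈ omega G (n+1) → boundary V n x ∈ omega G n
  | 0, _, hx => hx.2
  | _ + 1, x, hx => Submodule.mem_inf.2 ⟨hx.2, by
      rw [Submodule.mem_comap, boundary_boundary]
      exact zero_mem _⟩

section Poset

variable {G : Digraph V} {f : V → ℝ}

omit [Fintype V] [DecidableEq V] in
lemma Allowed.rel (hG : G.Transitive) {n : ℕ} {p : Path V n} (hp : Allowed G p)
    {i j : Fin (n+1)} (hij : i < j) : G.E (p i) (p j) := by
  have : IsTrans V G.E := ⟨hG⟩
  exact (Fin.liftFun_iff_succ G.E).2 hp hij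

omit [Fintype V] [DecidableEq V] in
lemma Allowed.injective (hG : G.Transitive) {n : ℕ} {p : Path V n} (hp : Allowed G p) :
    Function.Injective p := by
  intro i j h
  rcases lt_trichotomy i j with hij | hij | hij
  · exact absurd (h ▸ hp.rel hG hij) (G.irrefl _)
  · exact hij
  · exact absurd (h ▸ hp.rel hG hij) (G.irrefl _)

omit [Fintype V] [DecidableEq V] in
lemma Allowed.face (hG : G.Transitive) {n : ℕ} {p : Path V (n+1)} (hp : Allowed G p)
    (i : Fin (n+2)) : Allowed G (face i p) := fun _ =>
  hp.rel hG (Fin.strictMono_succAbove i Fin.castSucc_lt_succ)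

omit [Fintype V] [DecidableEq V] in
lemma fPath_face {n : ℕ} (p : Path V (n+1)) (i : Fin (n+2)) :
    fPath f p = f (p i) + fPath f (face i p) :=
  Fin.sum_univ_succAbove _ i

omit [Fintype V] [DecidableEq V] in
lemma face_injective {n : ℕ} {p : Path V (n+1)} (hp : Function.Injective p) {i j : Fin (n+2)}
    (h : face i p = face j p) : i = j := by
  by_contra hij
  obtain ⟨k, hk⟩ := Fin.exists_succAbove_eq (Ne.symm hij)
  have := congrFun h k
  simp only [face, Function.comp_apply, hk] at this
  exact Fin.succAbove_ne j k (hp this).symm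

omit [Fintype V] [DecidableEq V] in
/-- A path allowed on a transitive digraph has at most one vertex where `f` vanishes. -/
lemma IsMorse.zero_unique (hf : IsMorse G f) (hG : G.Transitive) {n : ℕ} {p : Path V (n+1)}
    (hp : Allowed G p) {i j : Fin (n+2)} (hi : f (p i) = 0) (hj : f (p j) = 0) : i = j := by
  have ei := fPath_face (f := f) p i
  have ej := fPath_face (f := f) p j
  exact face_injective (hp.injective hG) (hf.2.2 n p hp _ _ (hp.face hG i) (hp.face hG j)
    ⟨i, rfl⟩ ⟨j, rfl⟩ (by linarith) (by linarith))

omit [Fintype V] [DecidableEq V] in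
lemma IsMorse.not_hasEqualCoface (hf : IsMorse G f) (hG : G.Transitive) {n : ℕ} {p : Path V n}
    {i : Fin (n+1)} (hi : f (p i) = 0) : ¬ HasEqualCoface G f p := by
  rintro ⟨γ, hγ, ⟨j, rfl⟩, h⟩
  have hj : f (γ j) = 0 := by
    have := fPath_face (f := f) γ j
    linarith
  exact Fin.succAbove_ne j i (hf.zero_unique hG hγ hi hj)

lemma grad_unitP {n : ℕ} (α : Path V n) : grad G f n (unitP α) = gradFun G f α := by
  change ∑ β : Path V n, (unitP α : Chain V n) β • gradFun G f β = _
  rw [Finset.sum_eq_single α]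
  · simp [unitP]
  · intro b _ hb
    simp [unitP, hb]
  · simp

lemma gradFun_eq_zero {n : ℕ} {α : Path V n} (h : ¬ (Allowed G α ∧ HasEqualCoface G f α)) :
    gradFun G f α = 0 :=
  dif_neg h

lemma gradFun_face (hf : IsMorse G f) (hG : G.Transitive) {n : ℕ} {γ : Path V (n+1)}
    (hγ : Allowed G γ) {i : Fin (n+2)} (hi : f (γ i) = 0) :
    gradFun G f (face i γ) = (-(-1:ℝ)^(i:ℕ)) • unitP γ := by
  have e := fPath_face (f := f) γ i
  have h : Allowed G (face i γ) ∧ ∃ γ' : Path V (n+1), Allowed G γ' ∧ IsFace (face i γ) γ' ∧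
      fPath f γ' = fPath f (face i γ) := ⟨hγ.face hG i, γ, hγ, ⟨i, rfl⟩, by linarith⟩
  have hc : h.2.choose = γ := hf.2.1 n _ h.1 _ _ h.2.choose_spec.1 hγ h.2.choose_spec.2.1 ⟨i, rfl⟩
    h.2.choose_spec.2.2 (by linarith)
  have hb : boundary V n (unitP γ) (face i γ) = (-1:ℝ)^(i:ℕ) := by
    rw [boundary_unitP, Finset.sum_apply, Finset.sum_eq_single i]
    · simp [unitP]
    · intro j _ hj
      have : face i γ ≠ face j γ := fun h => hj (face_injective (hγ.injective hG) h).symm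
      simp [unitP, this]
    · simp
  rw [gradFun, dif_pos h, hc, hb]

omit [Fintype V] [DecidableEq V] in
lemma exists_face_of_hasEqualCoface {n : ℕ} {α : Path V n} (h : HasEqualCoface G f α) :
    ∃ (γ : Path V (n+1)) (i : Fin (n+2)), Allowed G γ ∧ f (γ i) = 0 ∧ face i γ = α := by
  obtain ⟨γ, hγ, ⟨i, rfl⟩, e⟩ := h
  have := fPath_face (f := f) γ i
  exact ⟨γ, i, hγ, by linarith, rfl⟩

lemma grad_grad (hf : IsMorse G f) (hG : G.Transitive) {n : ℕ} (x : Chain V n) :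
    grad G f (n+1) (grad G f n x) = 0 := by
  suffices h : (grad G f (n+1)).comp (grad G f n) = 0 from LinearMap.congr_fun h x
  refine linearMap_ext_unitP fun α => ?_
  rw [LinearMap.comp_apply, grad_unitP]
  by_cases h : Allowed G α ∧ HasEqualCoface G f α
  · obtain ⟨γ, i, hγ, hi, rfl⟩ := exists_face_of_hasEqualCoface h.2
    rw [gradFun_face hf hG hγ hi, map_smul, grad_unitP,
      gradFun_eq_zero fun h => hf.not_hasEqualCoface hG hi h.2]
    simp
  · simp [gradFun_eq_zero h]

lemma grad_boundary_unitP (hf : IsMorse G f) (hG : G.Transitive) {n : ℕ} {γ : Path V (n+1)}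
    (hγ : Allowed G γ) {i : Fin (n+2)} (hi : f (γ i) = 0) :
    grad G f n (boundary V n (unitP γ)) = -unitP γ := by
  rw [boundary_unitP, map_sum, Finset.sum_eq_single i]
  · rw [map_smul, grad_unitP, gradFun_face hf hG hγ hi, smul_smul, mul_neg, ← pow_add]
    simp
  · intro j _ hj
    obtain ⟨k, hk⟩ := Fin.exists_succAbove_eq hj.symm
    have hz : f (face j γ k) = 0 := by
      simp only [face, Function.comp_apply, hk, hi]
    rw [map_smul, grad_unitP, gradFun_eq_zero fun h => hf.not_hasEqualCoface hG hz h.2, smul_zero]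
  · simp

lemma grad_boundary_grad (hf : IsMorse G f) (hG : G.Transitive) {n : ℕ} (x : Chain V n) :
    grad G f n (boundary V n (grad G f n x)) = -grad G f n x := by
  suffices h : (grad G f n).comp ((boundary V n).comp (grad G f n)) = -grad G f n from
    LinearMap.congr_fun h x
  refine linearMap_ext_unitP fun α => ?_
  rw [LinearMap.comp_apply, LinearMap.comp_apply, LinearMap.neg_apply, grad_unitP]
  by_cases h : Allowed G α ∧ HasEqualCoface G f α
  · obtain ⟨γ, i, hγ, hi, rfl⟩ := exists_face_of_hasEqualCoface h.2
    rw [gradFun_face hf hG hγ hi, map_smul, map_smul, grad_boundary_unitP hf hG hγ hi, smul_neg]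
  · simp [gradFun_eq_zero h]

lemma flow_apply {n : ℕ} (x : Chain V n) :
    flow G f n x = x + boundary V n (grad G f n x) + vd G f n x := rfl

lemma vd_boundary {n : ℕ} (x : Chain V (n+1)) : vd G f n (boundary V n x) = 0 := by
  cases n with
  | zero => rfl
  | succ n => simp [vd, boundary_boundary]

lemma flow_boundary {n : ℕ} (x : Chain V (n+1)) :
    flow G f n (boundary V n x) = boundary V n (flow G f (n+1) x) := by
  rw [flow_apply, flow_apply, vd_boundary, map_add, map_add, boundary_boundary]
  simp [vd]

lemma flow_grad (hf : IsMorse G f) (hG : G.Transitive) {n : ℕ} (x : Chain V n) :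
    flow G f (n+1) (grad G f n x) = 0 := by
  simp [flow_apply, vd, grad_grad hf hG, grad_boundary_grad hf hG]

lemma grad_vd (hf : IsMorse G f) (hG : G.Transitive) {n : ℕ} (x : Chain V n) :
    grad G f n (vd G f n x) = 0 := by
  cases n with
  | zero => simp [vd]
  | succ n => simp [vd, grad_grad hf hG]

lemma flow_vd (hf : IsMorse G f) (hG : G.Transitive) {n : ℕ} (x : Chain V n) :
    flow G f n (vd G f n x) = 0 := by
  cases n with
  | zero => simp [vd]
  | succ n => simp [vd, flow_grad hf hG]

lemma grad_flow (hf : IsMorse G f) (hG : G.Transitive) {n : ℕ} (x : Chain V n) :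
    grad G f n (flow G f n x) = 0 := by
  simp [flow_apply, grad_vd hf hG, grad_boundary_grad hf hG]

lemma flow_flow (hf : IsMorse G f) (hG : G.Transitive) {n : ℕ} (x : Chain V n) :
    flow G f n (flow G f n x) = flow G f n x := by
  conv_lhs => rw [flow_apply (x := x)]
  simp [flow_vd hf hG, flow_boundary, flow_grad hf hG]

/-- The kernel of the gradient consists of chains supported off the paths with an equal coface. -/
lemma eq_zero_of_grad_eq_zero (hf : IsMorse G f) (hG : G.Transitive) {n : ℕ} {x : Chain V n}
    (hx : grad G f n x = 0) {p : Path V n} (hp : HasEqualCoface G f p) : x p = 0 := by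
  obtain ⟨γ, i, hγ, hi, rfl⟩ := exists_face_of_hasEqualCoface hp
  have h : ∑ α : Path V n, x α * gradFun G f α γ = 0 := by
    have h := congrFun hx γ
    change (∑ α : Path V n, x α • gradFun G f α) γ = 0 at h
    simpa [Finset.sum_apply] using h
  rw [Finset.sum_eq_single (face i γ)] at h
  · simpa [gradFun_face hf hG hγ hi, unitP] using h
  · intro α _ hα
    by_cases hc : Allowed G α ∧ HasEqualCoface G f α
    · obtain ⟨γ', j, hγ', hj, rfl⟩ := exists_face_of_hasEqualCoface hc.2
      have hne : γ ≠ γ' := by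
        rintro rfl
        exact hα (by rw [hf.zero_unique hG hγ hi hj])
      simp [gradFun_face hf hG hγ' hj, unitP, hne]
    · simp [gradFun_eq_zero hc]
  · simp

lemma flow_unitP_of_hasEqualFace (hf : IsMorse G f) (hG : G.Transitive) {n : ℕ} {p : Path V n}
    (hp : Allowed G p) (h : HasEqualFace G f n p) : flow G f n (unitP p) = 0 := by
  cases n with
  | zero => exact h.elim
  | succ n =>
    obtain ⟨β, -, ⟨i, rfl⟩, e⟩ := h
    have := fPath_face (f := f) p i
    have hz := grad_boundary_unitP hf hG hp (i := i) (by linarith)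
    rw [← neg_neg (unitP p), ← hz, map_neg, flow_grad hf hG, neg_zero]

lemma grad_apply_of_critical (hf : IsMorse G f) (hG : G.Transitive) {n : ℕ} (x : Chain V n)
    {p : Path V (n+1)} (hp : IsCritical G f p) : grad G f n x p = 0 := by
  change (∑ α : Path V n, x α • gradFun G f α) p = 0
  rw [Finset.sum_apply]
  refine Finset.sum_eq_zero fun α _ => ?_
  by_cases hc : Allowed G α ∧ HasEqualCoface G f α
  · obtain ⟨γ, i, hγ, hi, rfl⟩ := exists_face_of_hasEqualCoface hc.2
    have hne : p ≠ γ := by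
      rintro rfl
      have := fPath_face (f := f) p i
      exact hp.2.2 ⟨_, hγ.face hG i, ⟨i, rfl⟩, by linarith⟩
    simp [gradFun_face hf hG hγ hi, unitP, hne]
  · simp [gradFun_eq_zero hc]

lemma vd_apply_of_critical (hf : IsMorse G f) (hG : G.Transitive) {n : ℕ} (x : Chain V n)
    {p : Path V n} (hp : IsCritical G f p) : vd G f n x p = 0 := by
  cases n with
  | zero => rfl
  | succ n => exact grad_apply_of_critical hf hG _ hp

end Poset

section Critical

variable {G Gbar : Digraph V} {f : V → ℝ}

lemma grad_eq_zero_of_mem_critSpan {n : ℕ} {x : Chain V n}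
    (hx : x ∈ critSpan G Gbar f n) : grad Gbar f n x = 0 := by
  change ∑ α : Path V n, x α • gradFun Gbar f α = 0
  refine Finset.sum_eq_zero fun α _ => ?_
  by_cases hc : Allowed Gbar α ∧ HasEqualCoface Gbar f α
  · rw [mem_critSpan_iff.1 hx α fun h => h.1.2.1 hc.2, zero_smul]
  · rw [gradFun_eq_zero hc, smul_zero]

lemma flow_of_mem_critSpan {n : ℕ} {x : Chain V n} (hx : x ∈ critSpan G Gbar f n) :
    flow Gbar f n x = x + vd Gbar f n x := by
  simp [flow_apply, grad_eq_zero_of_mem_critSpan hx]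

lemma eq_zero_of_flow_eq_zero (hf : IsMorse Gbar f) (hG : Gbar.Transitive) {n : ℕ} {x : Chain V n}
    (hx : x ∈ critSpan G Gbar f n) (h : flow Gbar f n x = 0) : x = 0 := by
  funext p
  by_cases hp : IsCritical Gbar f p ∧ Allowed G p
  · have := congrFun (flow_of_mem_critSpan hx ▸ h) p
    simpa [vd_apply_of_critical hf hG x hp.1] using this
  · exact mem_critSpan_iff.1 hx p hp

/-- Every flow-invariant chain allowed on `G` is the flow of a critical chain. -/
lemma exists_critSpan_flow_eq (hf : IsMorse Gbar f) (hG : Gbar.Transitive)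
    (hle : ∀ u v, G.E u v → Gbar.E u v) {n : ℕ} {x : Chain V n} (hx : x ∈ pSpan G n)
    (hfix : flow Gbar f n x = x) : ∃ c ∈ critSpan G Gbar f n, flow Gbar f n c = x := by
  let c : Chain V n := fun p => if IsCritical Gbar f p then x p else 0
  have hc : c ∈ critSpan G Gbar f n := by
    refine mem_critSpan_iff.2 fun p hp => ?_
    by_cases h : IsCritical Gbar f p
    · have h0 : x p = 0 := mem_pSpan_iff.1 hx p fun h' => hp ⟨h, h'⟩
      simp [c, h0]
    · simp [c, h]
  have hgrad : grad Gbar f n x = 0 := hfix ▸ grad_flow hf hG x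
  have hdiff : flow Gbar f n (x - c) = 0 := by
    rw [← sum_smul_unitP (x - c), map_sum]
    refine Finset.sum_eq_zero fun p _ => ?_
    rw [map_smul]
    by_cases hcr : IsCritical Gbar f p
    · simp [c, hcr]
    by_cases ha : Allowed G p
    · have hab : Allowed Gbar p := fun i => hle _ _ (ha i)
      by_cases hco : HasEqualCoface Gbar f p
      · simp [c, hcr, eq_zero_of_grad_eq_zero hf hG hgrad hco]
      · have hfa : HasEqualFace Gbar f n p := by
          by_contra h
          exact hcr ⟨hab, hco, h⟩
        rw [flow_unitP_of_hasEqualFace hf hG hab hfa, smul_zero]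
    · simp [c, hcr, mem_pSpan_iff.1 hx p ha]
  refine ⟨c, hc, ?_⟩
  rw [map_sub, hfix, sub_eq_zero] at hdiff
  exact hdiff.symm

lemma flow_mem_omega
    (hinv : ∀ n, ∀ x ∈ omega G n, grad Gbar f n x ∈ omega G (n+1)) {n : ℕ} {x : Chain V n}
    (hx : x ∈ omega G n) : flow Gbar f n x ∈ omega G n := by
  rw [flow_apply]
  refine add_mem (add_mem hx (boundary_mem_omega (hinv n x hx))) ?_
  cases n with
  | zero => exact zero_mem _
  | succ n => exact hinv n _ (boundary_mem_omega hx)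

lemma flow_mem_omega_of_mem_critSpan
    (hflow : ∀ (n : ℕ) (α : Path V n), Allowed G α → IsCritical Gbar f α →
      flow Gbar f n (unitP α) ∈ omega G n) {n : ℕ} {x : Chain V n}
    (hx : x ∈ critSpan G Gbar f n) : flow Gbar f n x ∈ omega G n := by
  induction hx using Submodule.span_induction with
  | mem y hy =>
    obtain ⟨p, hp, ha, rfl⟩ := hy
    exact hflow n p ha hp
  | zero => simp
  | add y z _ _ hy hz => simpa using add_mem hy hz
  | smul c y _ hy => simpa using Submodule.smul_mem _ c hy

end Critical

omit [Fintype V] [DecidableEq V] in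
/-- A linear map that respects cycles and boundaries, and is bijective modulo boundaries,
induces an isomorphism in homology. -/
lemma nonempty_homology_equiv {C C' : ∀ n, Submodule ℝ (Chain V n)}
    {D D' : ∀ n, Chain V (n+1) →ₗ[ℝ] Chain V n} {m : ℕ} (T : Chain V m →ₗ[ℝ] Chain V m)
    (hcyc : ∀ x ∈ cycles C D m, T x ∈ cycles C' D' m)
    (hbdry : ∀ x ∈ (C (m+1)).map (D m), T x ∈ (C' (m+1)).map (D' m))
    (hinj : ∀ x ∈ cycles C D m, T x ∈ (C' (m+1)).map (D' m) → x ∈ (C (m+1)).map (D m))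
    (hsurj : ∀ y ∈ cycles C' D' m, ∃ x ∈ cycles C D m, T x - y ∈ (C' (m+1)).map (D' m)) :
    Nonempty (Homology C D m ≃ₗ[ℝ] Homology C' D' m) := by
  let F : Homology C D m →ₗ[ℝ] Homology C' D' m :=
    Submodule.mapQ _ _ (T.restrict hcyc) fun x hx => hbdry x hx
  refine ⟨LinearEquiv.ofBijective F ⟨?_, ?_⟩⟩
  · rw [injective_iff_map_eq_zero]
    intro q hq
    obtain ⟨x, rfl⟩ := Submodule.Quotient.mk_surjective _ q
    replace hq := (Submodule.Quotient.mk_eq_zero _).1 hq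
    exact (Submodule.Quotient.mk_eq_zero _).2 (hinj x x.2 hq)
  · intro q
    obtain ⟨y, rfl⟩ := Submodule.Quotient.mk_surjective _ q
    obtain ⟨x, hx, h⟩ := hsurj y y.2
    exact ⟨Submodule.Quotient.mk ⟨x, hx⟩, (Submodule.Quotient.eq _).2 h⟩

/-- Under `V̄`-invariance of `Ω_*(G)` and the flow condition, the homology of the
critical chain complex `(Crit_*(Ḡ) ∩ P_*(G), ∂̃)`, where `∂̃ = T⁻¹ ∘ ∂ ∘ T` with
`T : α ↦ α + V̄∂α`, is isomorphic to the path homology `H_m(G;ℝ)`. -/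
theorem stmt15 {V : Type} [Fintype V] [DecidableEq V] (G Gbar : Digraph V)
    (hcl : IsTransClosure G Gbar) (f : V → ℝ) (hf : IsMorse Gbar f)
    (hinv : ∀ n, ∀ x ∈ omega G n, grad Gbar f n x ∈ omega G (n+1))
    (hflow : ∀ (n : ℕ) (α : Path V n), Allowed G α → IsCritical Gbar f α →
      flow Gbar f n (unitP α) ∈ omega G n)
    (dTil : ∀ n, Chain V (n+1) →ₗ[ℝ] Chain V n)
    (hdTil : ∀ n, ∀ x ∈ critSpan G Gbar f (n+1),
      dTil n x ∈ critSpan G Gbar f n ∧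
      dTil n x + vd Gbar f n (dTil n x) = boundary V n (x + vd Gbar f (n+1) x))
    (m : ℕ) :
    Nonempty (Homology (critSpan G Gbar f) dTil m ≃ₗ[ℝ]
      Homology (omega G) (fun n => boundary V n) m) := by
  obtain ⟨hG, hle, -⟩ := hcl
  have hcomm : ∀ n, ∀ x ∈ critSpan G Gbar f (n+1),
      flow Gbar f n (dTil n x) = boundary V n (flow Gbar f (n+1) x) := fun n x hx => by
    rw [flow_of_mem_critSpan hx, flow_of_mem_critSpan (hdTil n x hx).1, (hdTil n x hx).2]
  have hlift : ∀ n, ∀ y ∈ omega G n,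
      ∃ c ∈ critSpan G Gbar f n, flow Gbar f n c = flow Gbar f n y := fun n y hy =>
    exists_critSpan_flow_eq hf hG hle (omega_le_pSpan G n (flow_mem_omega hinv hy))
      (flow_flow hf hG y)
  refine nonempty_homology_equiv (flow Gbar f m) ?_ ?_ ?_ ?_
  · intro x hx
    cases m with
    | zero => exact flow_mem_omega_of_mem_critSpan hflow hx
    | succ m =>
      refine Submodule.mem_inf.2 ⟨flow_mem_omega_of_mem_critSpan hflow hx.1, ?_⟩
      rw [LinearMap.mem_ker, ← hcomm m x hx.1, LinearMap.mem_ker.1 hx.2, map_zero]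
  · rintro _ ⟨x, hx, rfl⟩
    exact ⟨_, flow_mem_omega_of_mem_critSpan hflow hx, (hcomm m x hx).symm⟩
  · rintro x hx ⟨y, hy, e⟩
    have hxC : x ∈ critSpan G Gbar f m := by
      cases m with
      | zero => exact hx
      | succ m => exact hx.1
    obtain ⟨c, hc, hcy⟩ := hlift (m+1) y hy
    refine ⟨c, hc, ?_⟩
    have h : flow Gbar f m (dTil m c - x) = 0 := by
      rw [map_sub, hcomm m c hc, hcy, ← flow_boundary, e, flow_flow hf hG, sub_self]
    exact sub_eq_zero.1 (eq_zero_of_flow_eq_zero hf hG (sub_mem (hdTil m c hc).1 hxC) h)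
  · intro y hy
    have hyΩ : y ∈ omega G m := by
      cases m with
      | zero => exact hy
      | succ m => exact hy.1
    obtain ⟨c, hc, hcy⟩ := hlift m y hyΩ
    refine ⟨c, ?_, grad Gbar f m y, hinv m y hyΩ, ?_⟩
    · cases m with
      | zero => exact hc
      | succ m =>
        refine ⟨hc, LinearMap.mem_ker.2 (eq_zero_of_flow_eq_zero hf hG (hdTil m c hc).1 ?_)⟩
        rw [hcomm m c hc, hcy, ← flow_boundary, LinearMap.mem_ker.1 hy.2, map_zero]
    · have hvd : vd Gbar f m y = 0 := by
        cases m with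
        | zero => rfl
        | succ m => simp [vd, LinearMap.mem_ker.1 hy.2]
      rw [hcy, flow_apply, hvd]
      abel

end PathMorse
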